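/- arXiv:1712.01363 — 3 statements merged into one kernel-verified Lean document; each statement's English description precedes it below -/
import Mathlib

section
/- Let b > 0, let l ≥ −1/2 be a real number, fix x ∈ (0,b], and let K : [0,x] → ℂ be continuous. Define R(s) = (2Γ(l+3/2)/(√π·Γ(l+1)))·∫_s^x K(t)·t^{−l}·(t²−s²)^l dt for 0 < s < x. Then for every integer n > l+1 and every t ∈ (0,x) one has K(t) = (2√π/Γ(l+3/2))·(t^{l+1}/Γ(n−l−1))·(−(1/(2t))·d/dt)^n ∫_t^x (s²−t²)^{n−l−2}·s·R(s) ds, where the n-fold differential operator is applied to the function of t given by the integral. (This is the paper's Theorem 2.1, expressing the transmutation kernel K through its Erdélyi–Kober transform R; the overall constant is the one consistent with the paper's subsequent formulas.) -/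
open Real Set MeasureTheory

/-- The operator `f ↦ (t ↦ -f'(t)/(2t))` acting on complex-valued functions
of a real variable; its `n`-th iterate is `(-(1/(2t))·d/dt)^n`. -/
noncomputable def negHalfDerivC : (ℝ → ℂ) → (ℝ → ℂ) :=
  fun f t => -(deriv f t) / (2 * (t : ℂ))

lemma betaIntegrand_integrableOn_and_integral {a c : ℝ} (ha : 0 < a) (hc : 0 < c) :
    IntegrableOn (fun y : ℝ => y ^ (a - 1) * (1 - y) ^ (c - 1)) (Ioo 0 1) ∧
      ∫ y in Ioo (0 : ℝ) 1, y ^ (a - 1) * (1 - y) ^ (c - 1) =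
        Gamma a * Gamma c / Gamma (a + c) := by
  have hcast : EqOn
      (fun y : ℝ => (y : ℂ) ^ ((a : ℂ) - 1) * (1 - (y : ℂ)) ^ ((c : ℂ) - 1))
      (fun y : ℝ => ((y ^ (a - 1) * (1 - y) ^ (c - 1) : ℝ) : ℂ)) (Ioo 0 1) := by
    intro y hy
    simp only [Complex.ofReal_mul]
    rw [Complex.ofReal_cpow hy.1.le, Complex.ofReal_cpow (sub_nonneg.2 hy.2.le)]
    push_cast
    rfl
  have hint := Complex.betaIntegral_convergent (u := a) (v := c) (by simpa) (by simpa)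
  rw [intervalIntegrable_iff_integrableOn_Ioo_of_le zero_le_one,
    integrableOn_congr_fun hcast measurableSet_Ioo] at hint
  have hbeta := Complex.betaIntegral_eq_Gamma_mul_div (u := a) (v := c) (by simpa) (by simpa)
  rw [Complex.betaIntegral, intervalIntegral.integral_of_le zero_le_one, integral_Ioc_eq_integral_Ioo,
    setIntegral_congr_fun measurableSet_Ioo hcast, integral_complex_ofReal] at hbeta
  refine ⟨?_, ?_⟩
  · have h : Integrable _ _ := hint.re
    simpa using! h
  · rw [← Complex.ofReal_add, Complex.Gamma_ofReal, Complex.Gamma_ofReal,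
      Complex.Gamma_ofReal] at hbeta
    exact_mod_cast hbeta

lemma sq_betaIntegrand_integrableOn_and_integral {a c u t : ℝ} (ha : 0 < a) (hc : 0 < c)
    (hu : 0 < u) (hut : u < t) :
    IntegrableOn (fun s : ℝ => (s ^ 2 - u ^ 2) ^ (a - 1) * s * (t ^ 2 - s ^ 2) ^ (c - 1))
        (Ioo u t) ∧
      ∫ s in Ioo u t, (s ^ 2 - u ^ 2) ^ (a - 1) * s * (t ^ 2 - s ^ 2) ^ (c - 1) =
        Gamma a * Gamma c / (2 * Gamma (a + c)) * (t ^ 2 - u ^ 2) ^ (a + c - 1) := by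
  have hΔ : 0 < t ^ 2 - u ^ 2 := by nlinarith
  set Δ := t ^ 2 - u ^ 2 with hΔdef
  have hderiv : ∀ s ∈ Ioo u t,
      HasDerivWithinAt (fun s : ℝ => (s ^ 2 - u ^ 2) / Δ) (2 * s / Δ) (Ioo u t) s := by
    intro s _
    have := (((hasDerivAt_pow 2 s).sub_const (u ^ 2)).div_const Δ).hasDerivWithinAt (s := Ioo u t)
    simpa using this
  have hinj : InjOn (fun s : ℝ => (s ^ 2 - u ^ 2) / Δ) (Ioo u t) := by
    intro s hs r hr h
    have h' : s ^ 2 - u ^ 2 = r ^ 2 - u ^ 2 := (div_left_inj' hΔ.ne').1 h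
    exact (pow_left_inj₀ (hu.trans hs.1).le (hu.trans hr.1).le two_ne_zero).1 (by linarith)
  have himage : (fun s : ℝ => (s ^ 2 - u ^ 2) / Δ) '' Ioo u t = Ioo 0 1 := by
    ext y
    constructor
    · rintro ⟨s, hs, rfl⟩
      refine ⟨div_pos ?_ hΔ, (div_lt_one hΔ).2 ?_⟩ <;> nlinarith [hs.1, hs.2]
    · intro hy
      have hpos : 0 < y * Δ := mul_pos hy.1 hΔ
      have hlt : y * Δ < Δ := by nlinarith [hy.2]
      refine ⟨√(u ^ 2 + y * Δ), ⟨Real.lt_sqrt_of_sq_lt (by linarith), ?_⟩, ?_⟩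
      · rw [Real.sqrt_lt' (hu.trans hut)]
        linarith
      · simp only
        rw [Real.sq_sqrt (by positivity)]
        field_simp
        ring
  have hcongr : EqOn
      (fun s : ℝ => |2 * s / Δ| • (((s ^ 2 - u ^ 2) / Δ) ^ (a - 1) *
        (1 - (s ^ 2 - u ^ 2) / Δ) ^ (c - 1)))
      (fun s => 2 / Δ ^ (a + c - 1) *
        ((s ^ 2 - u ^ 2) ^ (a - 1) * s * (t ^ 2 - s ^ 2) ^ (c - 1))) (Ioo u t) := by
    intro s hs
    have hs0 : 0 < s := hu.trans hs.1
    have h1 : 0 < s ^ 2 - u ^ 2 := by nlinarith [hs.1]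
    have h2 : 0 < t ^ 2 - s ^ 2 := by nlinarith [hs.2]
    have h3 : 1 - (s ^ 2 - u ^ 2) / Δ = (t ^ 2 - s ^ 2) / Δ := by
      rw [eq_div_iff hΔ.ne', sub_mul, div_mul_cancel₀ _ hΔ.ne']
      rw [hΔdef]; ring
    have h4 : Δ ^ (a + c - 1) = Δ ^ (a - 1) * Δ ^ (c - 1) * Δ := by
      rw [← Real.rpow_add hΔ, ← Real.rpow_add_one hΔ.ne']
      congr 1
      ring
    simp only [smul_eq_mul]
    rw [abs_of_pos (by positivity), h3, Real.div_rpow h1.le hΔ.le, Real.div_rpow h2.le hΔ.le, h4]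
    have := Real.rpow_pos_of_pos hΔ (a - 1)
    have := Real.rpow_pos_of_pos hΔ (c - 1)
    field_simp
  have hpow := Real.rpow_pos_of_pos hΔ (a + c - 1)
  obtain ⟨hint, hval⟩ := betaIntegrand_integrableOn_and_integral ha hc
  rw [← himage] at hint hval
  rw [integrableOn_image_iff_integrableOn_abs_deriv_smul measurableSet_Ioo hderiv hinj,
    integrableOn_congr_fun hcongr measurableSet_Ioo] at hint
  rw [integral_image_eq_integral_abs_deriv_smul measurableSet_Ioo hderiv hinj,
    setIntegral_congr_fun measurableSet_Ioo hcongr, integral_const_mul] at hval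
  constructor
  · have := hint.const_mul (Δ ^ (a + c - 1) / 2)
    refine IntegrableOn.congr_fun this (fun s _ => ?_) measurableSet_Ioo
    field_simp
  · have hG := Real.Gamma_pos_of_pos (add_pos ha hc)
    field_simp at hval ⊢
    linarith

lemma integral_mul_integral_sq_sub_rpow {a c u x : ℝ} (ha : 0 < a) (hc : 0 < c)
    (hac : 1 ≤ a + c) (hu : 0 < u) (hux : u < x) {g : ℝ → ℂ} (hg : ContinuousOn g (Icc u x)) :
    ∫ s in u..x, (((s ^ 2 - u ^ 2) ^ (a - 1) * s : ℝ) : ℂ) *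
        ∫ t in s..x, g t * (((t ^ 2 - s ^ 2) ^ (c - 1) : ℝ) : ℂ) =
      ((Gamma a * Gamma c / (2 * Gamma (a + c)) : ℝ) : ℂ) *
        ∫ t in u..x, g t * (((t ^ 2 - u ^ 2) ^ (a + c - 1) : ℝ) : ℂ) := by
  set B := Gamma a * Gamma c / (2 * Gamma (a + c)) with hB
  let k : ℝ → ℝ → ℝ := fun s t =>
    (s ^ 2 - u ^ 2) ^ (a - 1) * s * (t ^ 2 - s ^ 2) ^ (c - 1)
  let f : ℝ → ℝ → ℂ := fun s t => if s < t then g t * (k s t : ℂ) else 0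
  let μ : Measure ℝ := volume.restrict (Ioo u x)
  have hk0 : ∀ s t, u < s → s < t → 0 ≤ k s t := by
    intro s t hs ht
    have hs0 : 0 < s := hu.trans hs
    have h1 : 0 ≤ s ^ 2 - u ^ 2 := by nlinarith
    have h2 : 0 ≤ t ^ 2 - s ^ 2 := by nlinarith
    positivity
  have hft : ∀ t, (fun s => f s t) = (Iio t).indicator (fun s => g t * (k s t : ℂ)) := by
    intro t
    ext s
    simp [f, indicator_apply]
  have hfs : ∀ s, f s = (Ioi s).indicator (fun t => g t * (k s t : ℂ)) := by
    intro s
    ext t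
    simp [f, indicator_apply]
  have hinter : ∀ t ∈ Ioo u x, Ioo u x ∩ Iio t = Ioo u t := by
    intro t ht
    ext s
    simp only [mem_inter_iff, mem_Ioo, mem_Iio]
    exact ⟨fun h => ⟨h.1.1, h.2⟩, fun h => ⟨⟨h.1, h.2.trans ht.2⟩, h.2⟩⟩
  have hinter' : ∀ s ∈ Ioo u x, Ioo u x ∩ Ioi s = Ioo s x := by
    intro s hs
    ext t
    simp only [mem_inter_iff, mem_Ioo, mem_Ioi]
    exact ⟨fun h => ⟨h.2, h.1.2⟩, fun h => ⟨⟨hs.1.trans h.1, h.2⟩, h.1⟩⟩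
  have hsection : ∀ t ∈ Ioo u x, ∫ s, f s t ∂μ =
      (B : ℂ) * (g t * (((t ^ 2 - u ^ 2) ^ (a + c - 1) : ℝ) : ℂ)) := by
    intro t ht
    rw [hft, setIntegral_indicator measurableSet_Iio, hinter t ht, integral_const_mul,
      integral_complex_ofReal, (sq_betaIntegrand_integrableOn_and_integral ha hc hu ht.1).2, ← hB]
    push_cast
    ring
  have hnorm : ∀ t ∈ Ioo u x, ∫ s, ‖f s t‖ ∂μ = B * (‖g t‖ * (t ^ 2 - u ^ 2) ^ (a + c - 1)) := by
    intro t ht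
    have : (fun s => ‖f s t‖) = (Iio t).indicator (fun s => ‖g t‖ * |k s t|) := by
      ext s
      by_cases h : s < t <;> simp [f, h]
    rw [this, setIntegral_indicator measurableSet_Iio, hinter t ht, integral_const_mul,
      setIntegral_congr_fun (g := fun s => k s t) measurableSet_Ioo
        (fun s hs => abs_of_nonneg (hk0 s t hs.1 hs.2)),
      (sq_betaIntegrand_integrableOn_and_integral ha hc hu ht.1).2]
    ring
  have hmeas : AEStronglyMeasurable (Function.uncurry f) (μ.prod μ) := by
    have hgm : AEStronglyMeasurable g μ :=
      (hg.mono Ioo_subset_Icc_self).aestronglyMeasurable measurableSet_Ioo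
    have hkm : Measurable (fun p : ℝ × ℝ => (k p.1 p.2 : ℂ)) := by
      refine Complex.measurable_ofReal.comp ?_
      fun_prop
    have := (hgm.comp_snd (μ := μ)).mul hkm.aestronglyMeasurable
    refine (this.indicator (measurableSet_lt measurable_fst measurable_snd)).congr
      (Filter.Eventually.of_forall fun p => ?_)
    simp [f, indicator_apply, Function.uncurry]
  have hcont : ContinuousOn (fun t => (t ^ 2 - u ^ 2) ^ (a + c - 1)) (Icc u x) :=
    ContinuousOn.rpow_const (by fun_prop) fun _ _ => Or.inr (by linarith)
  have hintegrable : Integrable (Function.uncurry f) (μ.prod μ) := by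
    rw [integrable_prod_iff' hmeas]
    constructor
    · refine (ae_restrict_iff' measurableSet_Ioo).2 (Filter.Eventually.of_forall fun t ht => ?_)
      change Integrable (fun s => f s t) μ
      rw [hft, integrable_indicator_iff measurableSet_Iio, IntegrableOn,
        Measure.restrict_restrict measurableSet_Iio, inter_comm, hinter t ht]
      exact ((sq_betaIntegrand_integrableOn_and_integral ha hc hu ht.1).1.ofReal).const_mul _
    · have : IntegrableOn (fun t => B * (‖g t‖ * (t ^ 2 - u ^ 2) ^ (a + c - 1))) (Ioo u x) :=
        ((continuousOn_const.mul (hg.norm.mul hcont)).integrableOn_Icc).mono_set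
          Ioo_subset_Icc_self
      exact this.congr_fun (fun t ht => (hnorm t ht).symm) measurableSet_Ioo
  have hswap := integral_integral_swap hintegrable
  rw [setIntegral_congr_fun measurableSet_Ioo hsection, integral_const_mul] at hswap
  rw [intervalIntegral.integral_of_le hux.le, intervalIntegral.integral_of_le hux.le,
    integral_Ioc_eq_integral_Ioo, integral_Ioc_eq_integral_Ioo, ← hswap]
  refine setIntegral_congr_fun measurableSet_Ioo fun s hs => ?_
  rw [hfs, setIntegral_indicator measurableSet_Ioi, hinter' s hs,
    intervalIntegral.integral_of_le hs.2.le, integral_Ioc_eq_integral_Ioo, ← integral_const_mul]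
  congr 1
  ext t
  simp only [k]
  push_cast
  ring

lemma intervalIntegrable_mul_sq_sub_pow {x u v : ℝ} (hv : v ∈ Ioo 0 x) {g : ℝ → ℂ}
    (hg : ContinuousOn g (Ioc 0 x)) (k : ℕ) :
    IntervalIntegrable (fun t => g t * ((t : ℂ) ^ 2 - (u : ℂ) ^ 2) ^ k) volume v x := by
  refine ContinuousOn.intervalIntegrable_of_Icc hv.2.le ?_
  refine (hg.mono fun t ht => ⟨hv.1.trans_le ht.1, ht.2⟩).mul ?_
  fun_prop

lemma hasDerivAt_integral_left_of_continuousOn {x u : ℝ} (hu : u ∈ Ioo 0 x) {g : ℝ → ℂ}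
    (hg : ContinuousOn g (Ioc 0 x)) :
    HasDerivAt (fun v : ℝ => ∫ t in v..x, g t) (-g u) u := by
  have hg' : ContinuousOn g (Ioo 0 x) := hg.mono Ioo_subset_Ioc_self
  refine intervalIntegral.integral_hasDerivAt_left
    (by simpa using intervalIntegrable_mul_sq_sub_pow (u := 0) hu hg 0)
    (hg'.stronglyMeasurableAtFilter isOpen_Ioo u hu)
    (hg'.continuousAt (isOpen_Ioo.mem_nhds hu))

lemma hasDerivAt_ofReal_sq (u : ℝ) : HasDerivAt (fun v : ℝ => (v : ℂ) ^ 2) (2 * u) u := by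
  simpa using HasDerivAt.fun_pow (Complex.ofRealCLM.hasDerivAt (x := u)) 2

lemma integral_mul_sq_sub_pow_succ_eventuallyEq {x u : ℝ} (hu : u ∈ Ioo 0 x) {g : ℝ → ℂ}
    (hg : ContinuousOn g (Ioc 0 x)) (k : ℕ) :
    (fun v : ℝ => ∫ t in v..x, g t * ((t : ℂ) ^ 2 - (v : ℂ) ^ 2) ^ (k + 1)) =ᶠ[nhds u]
      fun v : ℝ => (∫ t in v..x, g t * (t : ℂ) ^ 2 * ((t : ℂ) ^ 2 - (v : ℂ) ^ 2) ^ k) -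
        (v : ℂ) ^ 2 * ∫ t in v..x, g t * ((t : ℂ) ^ 2 - (v : ℂ) ^ 2) ^ k := by
  have hg2 : ContinuousOn (fun t : ℝ => g t * (t : ℂ) ^ 2) (Ioc 0 x) := hg.mul (by fun_prop)
  filter_upwards [isOpen_Ioo.mem_nhds hu] with v hv
  rw [← intervalIntegral.integral_const_mul, ← intervalIntegral.integral_sub
    (intervalIntegrable_mul_sq_sub_pow hv hg2 k)
    ((intervalIntegrable_mul_sq_sub_pow hv hg k).const_mul _)]
  congr 1
  ext t
  ring

lemma hasDerivAt_integral_mul_sq_sub_pow {x u : ℝ} (hu : u ∈ Ioo 0 x) (k : ℕ) {g : ℝ → ℂ}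
    (hg : ContinuousOn g (Ioc 0 x)) :
    HasDerivAt (fun v : ℝ => ∫ t in v..x, g t * ((t : ℂ) ^ 2 - (v : ℂ) ^ 2) ^ (k + 1))
      (-2 * u * (k + 1) * ∫ t in u..x, g t * ((t : ℂ) ^ 2 - (u : ℂ) ^ 2) ^ k) u := by
  induction k generalizing g with
  | zero =>
    have hg2 : ContinuousOn (fun t : ℝ => g t * (t : ℂ) ^ 2) (Ioc 0 x) := hg.mul (by fun_prop)
    refine HasDerivAt.congr_of_eventuallyEq ?_ (integral_mul_sq_sub_pow_succ_eventuallyEq hu hg 0)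
    have h := (hasDerivAt_integral_left_of_continuousOn hu hg2).fun_sub
      ((hasDerivAt_ofReal_sq u).fun_mul (hasDerivAt_integral_left_of_continuousOn hu hg))
    simp only [pow_zero, mul_one]
    convert! h using 1
    push_cast
    ring
  | succ k ih =>
    have hg2 : ContinuousOn (fun t : ℝ => g t * (t : ℂ) ^ 2) (Ioc 0 x) := hg.mul (by fun_prop)
    refine HasDerivAt.congr_of_eventuallyEq ?_
      (integral_mul_sq_sub_pow_succ_eventuallyEq hu hg (k + 1))
    have h := (ih hg2).fun_sub ((hasDerivAt_ofReal_sq u).fun_mul (ih hg))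
    convert! h using 1
    rw [(integral_mul_sq_sub_pow_succ_eventuallyEq hu hg k).eq_of_nhds]
    push_cast
    ring

lemma negHalfDerivC_congr {f g : ℝ → ℂ} {s : Set ℝ} (hs : IsOpen s) (h : EqOn f g s) :
    EqOn (negHalfDerivC f) (negHalfDerivC g) s := by
  intro t ht
  simp only [negHalfDerivC, (h.eventuallyEq_of_mem (hs.mem_nhds ht)).deriv_eq]

lemma negHalfDerivC_iterate_congr {f g : ℝ → ℂ} {s : Set ℝ} (hs : IsOpen s) (h : EqOn f g s)
    (n : ℕ) : EqOn (negHalfDerivC^[n] f) (negHalfDerivC^[n] g) s := by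
  induction n generalizing f g with
  | zero => exact h
  | succ n ih => exact ih (negHalfDerivC_congr hs h)

lemma negHalfDerivC_iterate_integral_mul_sq_sub_pow {x : ℝ} {g : ℝ → ℂ}
    (hg : ContinuousOn g (Ioc 0 x)) (m : ℕ) (C : ℂ) {u : ℝ} (hu : u ∈ Ioo 0 x) :
    negHalfDerivC^[m + 1]
        (fun v : ℝ => C * ∫ t in v..x, g t * ((t : ℂ) ^ 2 - (v : ℂ) ^ 2) ^ m) u =
      C * m.factorial * g u / (2 * u) := by
  induction m generalizing C with
  | zero =>
    have h := (hasDerivAt_integral_left_of_continuousOn hu hg).const_mul C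
    simp [negHalfDerivC, h.deriv]
  | succ m ih =>
    have hstep : EqOn
        (negHalfDerivC
          (fun v : ℝ => C * ∫ t in v..x, g t * ((t : ℂ) ^ 2 - (v : ℂ) ^ 2) ^ (m + 1)))
        (fun v : ℝ => C * (m + 1) * ∫ t in v..x, g t * ((t : ℂ) ^ 2 - (v : ℂ) ^ 2) ^ m)
        (Ioo 0 x) := by
      intro v hv
      have hv0 : (v : ℂ) ≠ 0 := Complex.ofReal_ne_zero.2 hv.1.ne'
      simp only [negHalfDerivC, ((hasDerivAt_integral_mul_sq_sub_pow hv m hg).const_mul C).deriv]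
      field_simp
    rw [Function.iterate_succ_apply, negHalfDerivC_iterate_congr isOpen_Ioo hstep (m + 1) hu, ih,
      Nat.factorial_succ]
    push_cast
    ring

/-- Expression of the transmutation kernel `K` through its
Erdélyi–Kober transform `R`. -/
theorem kernel_from_EK_transform
    (b l : ℝ) (hb : 0 < b) (hl : -(1/2) ≤ l)
    (x : ℝ) (hx : x ∈ Set.Ioc 0 b)
    (K R : ℝ → ℂ) (hK : ContinuousOn K (Set.Icc 0 x))
    (hR : ∀ s ∈ Set.Ioo 0 x, R s =
      ((2 * Real.Gamma (l + 3/2) / (Real.sqrt π * Real.Gamma (l + 1)) : ℝ) : ℂ) *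
        ∫ t in s..x, K t * ((t ^ (-l) : ℝ) : ℂ) * (((t ^ 2 - s ^ 2) ^ l : ℝ) : ℂ)) :
    ∀ n : ℕ, l + 1 < (n : ℝ) → ∀ t ∈ Set.Ioo 0 x,
      K t = ((2 * Real.sqrt π / Real.Gamma (l + 3/2) : ℝ) : ℂ) *
        ((t ^ (l + 1) / Real.Gamma ((n : ℝ) - l - 1) : ℝ) : ℂ) *
        (negHalfDerivC^[n]
          (fun u => ∫ s in u..x,
            (((s ^ 2 - u ^ 2) ^ ((n : ℝ) - l - 2) * s : ℝ) : ℂ) * R s)) t := by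
  intro n hn t ht
  obtain ⟨m, rfl⟩ : ∃ m, n = m + 1 := Nat.exists_eq_succ_of_ne_zero (by
    rintro rfl
    norm_num at hn
    linarith)
  simp only [Nat.cast_add, Nat.cast_one] at hn ⊢
  set C₁ : ℝ := 2 * Gamma (l + 3 / 2) / (√π * Gamma (l + 1)) with hC₁
  set B : ℝ := Gamma (m - l) * Gamma (l + 1) / (2 * m.factorial) with hB
  have hg : ContinuousOn (fun t : ℝ => K t * ((t ^ (-l) : ℝ) : ℂ)) (Ioc 0 x) := by
    refine (hK.mono Ioc_subset_Icc_self).mul (Complex.continuous_ofReal.comp_continuousOn ?_)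
    exact continuousOn_id.rpow_const fun s hs => Or.inl hs.1.ne'
  have hfun : EqOn
      (fun u : ℝ => ∫ s in u..x,
        (((s ^ 2 - u ^ 2) ^ ((m : ℝ) + 1 - l - 2) * s : ℝ) : ℂ) * R s)
      (fun u : ℝ => (C₁ * B : ℂ) * ∫ t in u..x,
        K t * ((t ^ (-l) : ℝ) : ℂ) * ((t : ℂ) ^ 2 - (u : ℂ) ^ 2) ^ m) (Ioo 0 x) := by
    intro u hu
    have key := integral_mul_integral_sq_sub_rpow (a := m - l) (c := l + 1) (by linarith)
      (by linarith) (by linarith [(Nat.cast_nonneg m : (0 : ℝ) ≤ m)]) hu.1 hu.2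
      (hg.mono fun s hs => ⟨hu.1.trans_le hs.1, hs.2⟩)
    rw [show (m : ℝ) - l + (l + 1) = m + 1 by ring, Gamma_nat_eq_factorial, ← hB] at key
    simp only [add_sub_cancel_right, rpow_natCast] at key
    push_cast at key
    simp only
    rw [mul_assoc, ← key, ← intervalIntegral.integral_const_mul,
      intervalIntegral.integral_of_le hu.2.le, intervalIntegral.integral_of_le hu.2.le,
      integral_Ioc_eq_integral_Ioo, integral_Ioc_eq_integral_Ioo]
    refine setIntegral_congr_fun measurableSet_Ioo fun s hs => ?_
    rw [hR s ⟨hu.1.trans hs.1, hs.2⟩, show (m : ℝ) + 1 - l - 2 = m - l - 1 by ring]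
    push_cast
    ring
  rw [negHalfDerivC_iterate_congr isOpen_Ioo hfun (m + 1) ht,
    negHalfDerivC_iterate_integral_mul_sq_sub_pow hg m _ ht]
  have ht0 : 0 < t := ht.1
  have hconst : 2 * √π / Gamma (l + 3 / 2) * (t ^ (l + 1) / Gamma ((m : ℝ) + 1 - l - 1)) *
      (C₁ * B * m.factorial * t ^ (-l) / (2 * t)) = 1 := by
    have h1 := Gamma_pos_of_pos (show 0 < l + 3 / 2 by linarith)
    have h2 := Gamma_pos_of_pos (show 0 < l + 1 by linarith)
    have h3 := Gamma_pos_of_pos (show 0 < (m : ℝ) - l by linarith)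
    have h4 := rpow_pos_of_pos ht0 l
    have h5 := Real.sqrt_pos.2 pi_pos
    rw [show (m : ℝ) + 1 - l - 1 = m - l by ring, rpow_add_one ht0.ne', rpow_neg ht0.le, hC₁, hB]
    generalize Gamma (l + 3 / 2) = G at h1 ⊢
    field_simp
  have hconst' := congrArg (fun r : ℝ => (r : ℂ) * K t) hconst
  simp only [Complex.ofReal_one, one_mul] at hconst'
  refine hconst'.symm.trans ?_
  push_cast
  ring
end

section
/- Let b > 0, let l ≥ 0 be an integer, fix x ∈ (0,b], and let K : [0,x] → ℂ be continuous. Define R(s) = (2Γ(l+3/2)/(√π·Γ(l+1)))·∫_s^x K(t)·t^{−l}·(t²−s²)^l dt for 0 < s < x. Then for every t ∈ (0,x), R is (l+1) times differentiable under the operator (1/(2t))·d/dt and K(t) = (−1)^{l+1}·(√π·t^{l+1}/Γ(l+3/2))·((1/(2t))·d/dt)^{l+1} R(t). -/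
open Real Set MeasureTheory

/-- The operator `f ↦ (t ↦ f'(t)/(2t))` acting on complex-valued functions of a
real variable; its `(l+1)`-th iterate is `((1/(2t))·d/dt)^{l+1}`. -/
noncomputable def halfDerivC : (ℝ → ℂ) → (ℝ → ℂ) :=
  fun f t => deriv f t / (2 * (t : ℂ))

/-- The integral of `g t * (t ^ 2 - s ^ 2) ^ m` over `s..x`, as a function of `s`. -/
noncomputable def sqDiffIntegral (g : ℝ → ℂ) (x : ℝ) (m : ℕ) (s : ℝ) : ℂ :=
  ∫ t in s..x, g t * (((t ^ 2 - s ^ 2) ^ m : ℝ) : ℂ)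

lemma intervalIntegrable_mul_sq_sub_sq_pow {g : ℝ → ℂ} {x s : ℝ} (hg : ContinuousOn g (Ioc 0 x))
    (hs : s ∈ Ioo 0 x) (m : ℕ) :
    IntervalIntegrable (fun t => g t * (((t ^ 2 - s ^ 2) ^ m : ℝ) : ℂ)) volume s x := by
  apply ContinuousOn.intervalIntegrable
  rw [uIcc_of_le hs.2.le]
  have hg' : ContinuousOn g (Icc s x) := hg.mono fun t ht => ⟨hs.1.trans_le ht.1, ht.2⟩
  fun_prop

lemma continuousOn_mul_sq {g : ℝ → ℂ} {S : Set ℝ} (hg : ContinuousOn g S) :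
    ContinuousOn (fun t => g t * ((t ^ 2 : ℝ) : ℂ)) S := by
  fun_prop

lemma sqDiffIntegral_succ {g : ℝ → ℂ} {x s : ℝ} (hg : ContinuousOn g (Ioc 0 x))
    (hs : s ∈ Ioo 0 x) (m : ℕ) :
    sqDiffIntegral g x (m + 1) s =
      sqDiffIntegral (fun t => g t * ((t ^ 2 : ℝ) : ℂ)) x m s
        - ((s ^ 2 : ℝ) : ℂ) * sqDiffIntegral g x m s := by
  unfold sqDiffIntegral
  rw [← intervalIntegral.integral_const_mul, ← intervalIntegral.integral_sub
    (intervalIntegrable_mul_sq_sub_sq_pow (continuousOn_mul_sq hg) hs m)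
    ((intervalIntegrable_mul_sq_sub_sq_pow hg hs m).const_mul _)]
  congr 1 with t
  push_cast
  ring

lemma hasDerivAt_sqDiffIntegral_zero {g : ℝ → ℂ} {x s : ℝ} (hg : ContinuousOn g (Ioc 0 x))
    (hs : s ∈ Ioo 0 x) : HasDerivAt (sqDiffIntegral g x 0) (-g s) s := by
  have hint := intervalIntegrable_mul_sq_sub_sq_pow hg hs 0
  simp only [pow_zero, Complex.ofReal_one, mul_one] at hint
  have hfun : sqDiffIntegral g x 0 = fun s => ∫ t in s..x, g t := by
    ext s
    simp [sqDiffIntegral]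
  have hcont : ContinuousOn g (Ioo 0 x) := hg.mono Ioo_subset_Ioc_self
  rw [hfun]
  exact intervalIntegral.integral_hasDerivAt_left hint
    (hcont.stronglyMeasurableAtFilter isOpen_Ioo s hs)
    (hcont.continuousAt (isOpen_Ioo.mem_nhds hs))

lemma hasDerivAt_sqDiffIntegral_succ (m : ℕ) {g : ℝ → ℂ} {x s : ℝ}
    (hg : ContinuousOn g (Ioc 0 x)) (hs : s ∈ Ioo 0 x) :
    HasDerivAt (sqDiffIntegral g x (m + 1))
      (-((m : ℂ) + 1) * (2 * s) * sqDiffIntegral g x m s) s := by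
  have hsq : HasDerivAt (fun s : ℝ => ((s ^ 2 : ℝ) : ℂ)) (2 * s) s := by
    simpa using (hasDerivAt_pow 2 s).ofReal_comp
  have step (k : ℕ) {g : ℝ → ℂ} (hg : ContinuousOn g (Ioc 0 x)) {u v : ℂ}
      (hu : HasDerivAt (sqDiffIntegral (fun t => g t * ((t ^ 2 : ℝ) : ℂ)) x k) u s)
      (hv : HasDerivAt (sqDiffIntegral g x k) v s) :
      HasDerivAt (sqDiffIntegral g x (k + 1))
        (u - (2 * s * sqDiffIntegral g x k s + ((s ^ 2 : ℝ) : ℂ) * v)) s := by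
    refine (hu.sub (hsq.mul hv)).congr_of_eventuallyEq ?_
    filter_upwards [isOpen_Ioo.mem_nhds hs] with y hy using sqDiffIntegral_succ hg hy k
  induction m generalizing g with
  | zero =>
    refine (step 0 hg (hasDerivAt_sqDiffIntegral_zero (continuousOn_mul_sq hg) hs)
      (hasDerivAt_sqDiffIntegral_zero hg hs)).congr_deriv ?_
    push_cast
    ring
  | succ m ih =>
    refine (step (m + 1) hg (ih (continuousOn_mul_sq hg)) (ih hg)).congr_deriv ?_
    rw [sqDiffIntegral_succ hg hs m]
    push_cast
    ring

lemma halfDerivC_iterate_sqDiffIntegral (l : ℕ) {g : ℝ → ℂ} {x : ℝ}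
    (hg : ContinuousOn g (Ioc 0 x)) {R : ℝ → ℂ} {c : ℂ}
    (hR : ∀ s ∈ Ioo 0 x, R s = c * sqDiffIntegral g x l s) {t : ℝ} (ht : t ∈ Ioo 0 x) :
    (∀ j < l + 1, DifferentiableAt ℝ (halfDerivC^[j] R) t) ∧
      halfDerivC^[l + 1] R t = c * (-1) ^ (l + 1) * (l.factorial : ℂ) * g t / (2 * t) := by
  have hderiv {F' : ℂ} {s : ℝ} (hs : s ∈ Ioo 0 x) (h : HasDerivAt (sqDiffIntegral g x l) F' s) :
      HasDerivAt R (c * F') s :=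
    (h.const_mul c).congr_of_eventuallyEq (by
      filter_upwards [isOpen_Ioo.mem_nhds hs] with u hu using hR u hu)
  induction l generalizing R c with
  | zero =>
    have h := hderiv ht (hasDerivAt_sqDiffIntegral_zero hg ht)
    refine ⟨fun j hj => ?_, ?_⟩
    · obtain rfl : j = 0 := by omega
      exact h.differentiableAt
    · simp [halfDerivC, h.deriv]
  | succ l ih =>
    have hR' : ∀ s ∈ Ioo 0 x,
        halfDerivC R s = c * -((l : ℂ) + 1) * sqDiffIntegral g x l s := by
      intro s hs
      have hs0 : (s : ℂ) ≠ 0 := Complex.ofReal_ne_zero.mpr hs.1.ne'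
      rw [halfDerivC, (hderiv hs (hasDerivAt_sqDiffIntegral_succ l hg hs)).deriv]
      field_simp
    obtain ⟨hdiff, hval⟩ := ih hR' fun {_ s} hs h =>
      (h.const_mul _).congr_of_eventuallyEq (by
        filter_upwards [isOpen_Ioo.mem_nhds hs] with u hu using hR' u hu)
    refine ⟨fun j hj => ?_, ?_⟩
    · cases j with
      | zero => exact (hderiv ht (hasDerivAt_sqDiffIntegral_succ l hg ht)).differentiableAt
      | succ j => exact hdiff j (by omega)
    · rw [Function.iterate_succ_apply, hval, Nat.factorial_succ]
      push_cast
      ring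

/-- For integer `l ≥ 0` the kernel `K` is recovered from `R` by
`(l+1)`-fold application of `(1/(2t))·d/dt`. -/
theorem kernel_from_EK_transform_int
    (b : ℝ) (hb : 0 < b) (l : ℕ) (x : ℝ) (hx : x ∈ Set.Ioc 0 b)
    (K R : ℝ → ℂ) (hK : ContinuousOn K (Set.Icc 0 x))
    (hR : ∀ s ∈ Set.Ioo 0 x, R s =
      ((2 * Real.Gamma ((l : ℝ) + 3/2) / (Real.sqrt π * Real.Gamma ((l : ℝ) + 1)) : ℝ) : ℂ) *
        ∫ t in s..x, K t * ((t ^ (-(l : ℝ)) : ℝ) : ℂ) * (((t ^ 2 - s ^ 2) ^ l : ℝ) : ℂ)) :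
    ∀ t ∈ Set.Ioo 0 x,
      (∀ j < l + 1, DifferentiableAt ℝ (halfDerivC^[j] R) t) ∧
      K t = (-1 : ℂ) ^ (l + 1) *
        ((Real.sqrt π * t ^ (l + 1) / Real.Gamma ((l : ℝ) + 3/2) : ℝ) : ℂ) *
        (halfDerivC^[l + 1] R) t := by
  intro t ht
  have hg : ContinuousOn (fun t : ℝ => K t * ((t ^ (-(l : ℝ)) : ℝ) : ℂ)) (Ioc 0 x) := by
    refine (hK.mono Ioc_subset_Icc_self).mul (Complex.continuous_ofReal.comp_continuousOn ?_)
    exact continuousOn_id.rpow_const fun u hu => Or.inl hu.1.ne'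
  obtain ⟨hdiff, hval⟩ := halfDerivC_iterate_sqDiffIntegral l hg hR ht
  refine ⟨hdiff, ?_⟩
  have ht0 : (t : ℂ) ≠ 0 := Complex.ofReal_ne_zero.mpr ht.1.ne'
  have hΓ : (Real.Gamma ((l : ℝ) + 3 / 2) : ℂ) ≠ 0 :=
    Complex.ofReal_ne_zero.mpr (Real.Gamma_pos_of_pos (by positivity)).ne'
  have hπ : (Real.sqrt π : ℂ) ≠ 0 :=
    Complex.ofReal_ne_zero.mpr (Real.sqrt_pos.mpr Real.pi_pos).ne'
  have hl : (l.factorial : ℂ) ≠ 0 := Nat.cast_ne_zero.mpr l.factorial_ne_zero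
  have hsign : ((-1 : ℂ) ^ (l + 1)) * (-1) ^ (l + 1) = 1 := by
    rw [← mul_pow]
    simp
  rw [hval, Real.Gamma_nat_eq_factorial, Real.rpow_neg ht.1.le, Real.rpow_natCast]
  generalize Real.Gamma ((l : ℝ) + 3 / 2) = γ at hΓ ⊢
  push_cast
  field_simp
  linear_combination (-K t * (t : ℂ) ^ (l + 1)) * hsign
end

section
/- Let l > −1/2 be a noninteger real number, set p = ⌊l⌋ and λ = l − p. Then for every integer k ≥ 0 all three Gamma values below are defined (their arguments are not nonpositive integers) and Γ(l+1−k)/(Γ(2+k−λ)·Γ(λ−1−k)) = (−1)^p/Γ(k−l). -/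
open Real

/-- Gamma-quotient identity for noninteger `l > -1/2`,
with `p = ⌊l⌋` and `λ = l - p = Int.fract l`:
`Γ(l+1-k)/(Γ(2+k-λ)Γ(λ-1-k)) = (-1)^p/Γ(k-l)`, all arguments being
away from the nonpositive integers. -/
theorem gamma_reflection_quotient
    (l : ℝ) (hl : -(1/2) < l) (hnl : ∀ n : ℤ, l ≠ (n : ℝ)) :
    ∀ k : ℕ,
      (∀ n : ℕ, l + 1 - k ≠ -(n : ℝ)) ∧
      (∀ n : ℕ, 2 + (k : ℝ) - Int.fract l ≠ -(n : ℝ)) ∧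
      (∀ n : ℕ, Int.fract l - 1 - k ≠ -(n : ℝ)) ∧
      Real.Gamma (l + 1 - k) /
          (Real.Gamma (2 + (k : ℝ) - Int.fract l) * Real.Gamma (Int.fract l - 1 - k)) =
        (-1 : ℝ) ^ (⌊l⌋) / Real.Gamma ((k : ℝ) - l) := by
  intro k
  have hp : Int.fract l = l - ⌊l⌋ := rfl
  have h1 : ∀ n : ℕ, l + 1 - k ≠ -(n : ℝ) := fun n h =>
    hnl (k - 1 - n) (by push_cast; linarith)
  have h2 : ∀ n : ℕ, 2 + (k : ℝ) - Int.fract l ≠ -(n : ℝ) := fun n h =>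
    hnl (⌊l⌋ + 2 + k + n) (by push_cast; linarith)
  have h3 : ∀ n : ℕ, Int.fract l - 1 - k ≠ -(n : ℝ) := fun n h =>
    hnl (⌊l⌋ + 1 + k - n) (by push_cast; linarith)
  have h4 : ∀ n : ℕ, (k : ℝ) - l ≠ -(n : ℝ) := fun n h =>
    hnl (k + n) (by push_cast; linarith)
  refine ⟨h1, h2, h3, ?_⟩
  have reflection_left := Real.Gamma_mul_Gamma_one_sub ((k : ℝ) - l)
  have reflection_right := Real.Gamma_mul_Gamma_one_sub (Int.fract l - 1 - k)
  have hsin : sin (π * (Int.fract l - 1 - k)) = (-1) ^ ⌊l⌋ * sin (π * ((k : ℝ) - l)) := by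
    have harg : π * (Int.fract l - 1 - k) =
        -(π * ((k : ℝ) - l)) - ((⌊l⌋ + 1 : ℤ) : ℝ) * π := by
      rw [hp]; push_cast; ring
    rw [harg, Real.sin_sub_int_mul_pi, Real.sin_neg, zpow_add_one₀ (by norm_num)]
    ring
  have hsq : ((-1 : ℝ) ^ ⌊l⌋) * (-1) ^ ⌊l⌋ = 1 := by
    rw [← mul_zpow]; simp
  have hsin_ne : sin (π * ((k : ℝ) - l)) ≠ 0 := by
    intro h
    rw [h, div_zero, show 1 - ((k : ℝ) - l) = l + 1 - k by ring] at reflection_left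
    exact mul_ne_zero (Real.Gamma_ne_zero h4) (Real.Gamma_ne_zero h1) reflection_left
  have hsign : ((-1 : ℝ) ^ ⌊l⌋) ≠ 0 := left_ne_zero_of_mul_eq_one hsq
  rw [show 1 - ((k : ℝ) - l) = l + 1 - k by ring, eq_div_iff hsin_ne] at reflection_left
  rw [show 1 - (Int.fract l - 1 - k) = 2 + (k : ℝ) - Int.fract l by ring, hsin,
    eq_div_iff (mul_ne_zero hsign hsin_ne)] at reflection_right
  rw [div_eq_div_iff (mul_ne_zero (Real.Gamma_ne_zero h2) (Real.Gamma_ne_zero h3))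
    (Real.Gamma_ne_zero h4)]
  apply mul_right_cancel₀ hsin_ne
  linear_combination reflection_left - reflection_right
end
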